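/- Let n ≥ 3. There exists a constant C ∈ (0,1), depending only on n, p, q, γ, with the following property: for every nonnegative Borel measure σ on ℝⁿ, finite on bounded sets, with W_Gσ(x) < ∞ for every x ∈ ℝⁿ, and every Borel function u : ℝⁿ → [0,∞] with σ({x : u(x) > 0}) > 0 satisfying u(x) ≥ W_G((f∘u)·dσ)(x) for every x ∈ ℝⁿ, one has u(x) ≥ C · (W_Gσ(x))^(1/(1−γ)) for every x ∈ ℝⁿ. -/

import Mathlib

open MeasureTheory Metric Set
open scoped ENNReal

noncomputable def gfun (p q : ℝ) (t : ℝ≥0∞) : ℝ≥0∞ := t ^ (p - 1) + t ^ (q - 1)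

noncomputable def ffun (p q γ : ℝ) (t : ℝ≥0∞) : ℝ≥0∞ :=
  t ^ ((p - 1) * γ) + t ^ ((q - 1) * γ)

noncomputable def Ffun (p q γ : ℝ) (t : ℝ≥0∞) : ℝ≥0∞ :=
  t ^ ((p - 1) * γ + 1) / ENNReal.ofReal ((p - 1) * γ + 1)
    + t ^ ((q - 1) * γ + 1) / ENNReal.ofReal ((q - 1) * γ + 1)

/-- The Wolff-type potential `W_G σ(x) = ∫₀^∞ h(σ(B(x,t))/t^(n−1)) dt`,
where `h` is the inverse of `g`. -/
noncomputable def wolffG (n : ℕ) (h : ℝ≥0∞ → ℝ≥0∞)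
    (σ : Measure (EuclideanSpace ℝ (Fin n))) (x : EuclideanSpace ℝ (Fin n)) : ℝ≥0∞ :=
  ∫⁻ t in Set.Ioi (0 : ℝ), h (σ (ball x t) / ENNReal.ofReal t ^ (n - 1))

/-- The classical Wolff potential `W_s σ(x) = ∫₀^∞ (σ(B(x,t))/t^(n−1))^(1/(s−1)) dt`. -/
noncomputable def wolffS (n : ℕ) (s : ℝ)
    (σ : Measure (EuclideanSpace ℝ (Fin n))) (x : EuclideanSpace ℝ (Fin n)) : ℝ≥0∞ :=
  ∫⁻ t in Set.Ioi (0 : ℝ), (σ (ball x t) / ENNReal.ofReal t ^ (n - 1)) ^ (1 / (s - 1))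

/-- Condition (A) on the measure σ. -/
def condA (n : ℕ) (p q γ : ℝ) (σ : Measure (EuclideanSpace ℝ (Fin n))) : Prop :=
  ∀ s ∈ ({p, q} : Set ℝ),
    ∀ θ ∈ ({1 / (1 - γ), (p - 1) / (p - 1 - γ * (q - 1)),
            (q - 1) / (q - 1 - γ * (p - 1))} : Set ℝ),
      (∫⁻ x, Ffun p q γ ((wolffS n s σ x) ^ θ) ∂σ) < ⊤

lemma ffun_eq_gfun_rpow (p q γ : ℝ) (t : ℝ≥0∞) : ffun p q γ t = gfun p q (t ^ γ) := by
  simp only [ffun, gfun, ← ENNReal.rpow_mul, mul_comm γ]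

lemma gfun_mono {p q : ℝ} (hp : 1 < p) (hpq : p < q) : Monotone (gfun p q) := by
  intro a b hab
  unfold gfun
  gcongr
  linarith

lemma gfun_zero {p q : ℝ} (hp : 1 < p) (hpq : p < q) : gfun p q 0 = 0 := by
  simp [gfun, ENNReal.zero_rpow_of_pos (sub_pos.2 hp),
    ENNReal.zero_rpow_of_pos (sub_pos.2 (hp.trans hpq))]

lemma gfun_mul_le {p q : ℝ} (hp : 1 < p) (hpq : p < q) (a b : ℝ≥0∞) :
    gfun p q (a * b) ≤ gfun p q a * gfun p q b := by
  have h1 : 0 ≤ p - 1 := by linarith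
  have h2 : 0 ≤ q - 1 := by linarith
  simp only [gfun, ENNReal.mul_rpow_of_nonneg _ _ h1, ENNReal.mul_rpow_of_nonneg _ _ h2,
    add_mul, mul_add]
  gcongr
  · exact le_self_add
  · exact le_add_self

lemma measurable_ffun {p q γ : ℝ} : Measurable (ffun p q γ) := by
  unfold ffun
  fun_prop

lemma ffun_mono {p q γ : ℝ} (hp : 1 < p) (hpq : p < q) (hγ : 0 ≤ γ) : Monotone (ffun p q γ) := by
  intro a b hab
  rw [ffun_eq_gfun_rpow, ffun_eq_gfun_rpow]
  exact gfun_mono hp hpq (ENNReal.rpow_le_rpow hab hγ)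

lemma ffun_ne_zero {p q γ : ℝ} (hp : 1 < p) (hγ : 0 < γ) {t : ℝ≥0∞} (ht : t ≠ 0) :
    ffun p q γ t ≠ 0 := by
  have : 0 < (p - 1) * γ := mul_pos (by linarith) hγ
  simp [ffun, ENNReal.rpow_eq_zero_iff, ht, this.le]

section Inverse

variable {p q : ℝ} {h : ℝ≥0∞ → ℝ≥0∞}

lemma inverse_mono (hp : 1 < p) (hpq : p < q) (hhg : ∀ s, gfun p q (h s) = s) : Monotone h := by
  intro a b hab
  by_contra! hlt
  have := gfun_mono hp hpq hlt.le
  rw [hhg, hhg] at this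
  rw [le_antisymm hab this] at hlt
  exact lt_irrefl _ hlt

lemma mul_inverse_le (hp : 1 < p) (hpq : p < q) (hgh : ∀ t, h (gfun p q t) = t)
    (hhg : ∀ s, gfun p q (h s) = s) (a s : ℝ≥0∞) : a * h s ≤ h (gfun p q a * s) := by
  have := inverse_mono hp hpq hhg (gfun_mul_le hp hpq a (h s))
  rwa [hgh, hhg] at this

lemma inverse_ne_zero (hp : 1 < p) (hpq : p < q) (hhg : ∀ s, gfun p q (h s) = s) {s : ℝ≥0∞}
    (hs : s ≠ 0) : h s ≠ 0 := by
  intro h0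
  apply hs
  rw [← hhg s, h0, gfun_zero hp hpq]

lemma inverse_le_one (hp : 1 < p) (hpq : p < q) (hgh : ∀ t, h (gfun p q t) = t)
    (hhg : ∀ s, gfun p q (h s) = s) {s : ℝ≥0∞} (hs : s ≤ 1) : h s ≤ 1 := by
  have h1 : s ≤ gfun p q 1 := hs.trans (by simp [gfun])
  simpa [hgh] using inverse_mono hp hpq hhg h1

end Inverse

section Potential

variable {n : ℕ} {h : ℝ≥0∞ → ℝ≥0∞} {τ : Measure (EuclideanSpace ℝ (Fin n))}

lemma measurable_wolffG_integrand (hh : Monotone h) (x : EuclideanSpace ℝ (Fin n)) :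
    Measurable fun t : ℝ => h (τ (ball x t) / ENNReal.ofReal t ^ (n - 1)) := by
  have h1 : Monotone fun t : ℝ => τ (ball x t) := fun s t hst => measure_mono (ball_subset_ball hst)
  have h2 := h1.measurable
  exact hh.measurable.comp (h2.div (by fun_prop))

lemma wolffG_mono_measure (hh : Monotone h) {τ' : Measure (EuclideanSpace ℝ (Fin n))}
    (hτ : τ ≤ τ') (x : EuclideanSpace ℝ (Fin n)) : wolffG n h τ x ≤ wolffG n h τ' x := by
  refine lintegral_mono fun t => hh ?_
  gcongr

lemma mul_tail_le_wolffG (hh : Monotone h) {a c : ℝ≥0∞}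
    (hac : ∀ s, c * h s ≤ h (a * s)) (ha : a = (2 ^ (n - 1))⁻¹) {x y : EuclideanSpace ℝ (Fin n)}
    {t : ℝ} (ht : 0 ≤ t) (hy : y ∈ ball x t) :
    c * ∫⁻ s in Ioi t, h (τ (ball x s) / ENNReal.ofReal s ^ (n - 1)) ≤ wolffG n h τ y := by
  set F : ℝ → ℝ≥0∞ := fun s => h (τ (ball y s) / ENNReal.ofReal s ^ (n - 1)) with hF
  have hshift : ∫⁻ s in Ioi t, F (s + t) ≤ wolffG n h τ y := by
    calc ∫⁻ s in Ioi t, F (s + t)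
        = ∫⁻ s, (Ioi t).indicator (fun s => F (s + t)) s :=
          (lintegral_indicator measurableSet_Ioi _).symm
      _ ≤ ∫⁻ s, (Ioi 0).indicator F (s + t) := by
          refine lintegral_mono fun s => ?_
          by_cases hs : s ∈ Ioi t
          · have hs' : s + t ∈ Ioi (0 : ℝ) := by
              rw [mem_Ioi] at hs ⊢
              linarith
            rw [indicator_of_mem hs, indicator_of_mem hs']
          · rw [indicator_of_notMem hs]
            exact zero_le
      _ = ∫⁻ s, (Ioi 0).indicator F s := lintegral_add_right_eq_self _ t
      _ = wolffG n h τ y := lintegral_indicator measurableSet_Ioi _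
  refine le_trans ?_ hshift
  rw [← lintegral_const_mul _ (measurable_wolffG_integrand hh x)]
  refine setLIntegral_mono' measurableSet_Ioi fun s hs => (hac _).trans (hh ?_)
  rw [mem_Ioi] at hs
  have hs0 : 0 < s := ht.trans_lt hs
  have hsub : ball x s ⊆ ball y (s + t) := by
    refine ball_subset_ball' ?_
    rw [dist_comm]
    linarith [mem_ball.1 hy]
  have hpow : ENNReal.ofReal (s + t) ^ (n - 1) ≤ 2 ^ (n - 1) * ENNReal.ofReal s ^ (n - 1) := by
    rw [← mul_pow]
    gcongr
    rw [← ENNReal.ofReal_ofNat, ← ENNReal.ofReal_mul (by norm_num)]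
    exact ENNReal.ofReal_le_ofReal (by linarith)
  calc a * (τ (ball x s) / ENNReal.ofReal s ^ (n - 1))
      = τ (ball x s) / (2 ^ (n - 1) * ENNReal.ofReal s ^ (n - 1)) := by
        rw [ha, div_eq_mul_inv, div_eq_mul_inv, ENNReal.mul_inv (by simp) (by simp)]
        ring
    _ ≤ τ (ball y (s + t)) / ENNReal.ofReal (s + t) ^ (n - 1) :=
        ENNReal.div_le_div (measure_mono hsub) hpow

end Potential

lemma setLIntegral_Ioi_eq_iSup (m : ℝ → ℝ≥0∞) :
    ∫⁻ s in Ioi (0 : ℝ), m s = ⨆ k : ℕ, ∫⁻ s in Ioc (0 : ℝ) k, m s := by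
  rw [← setLIntegral_iUnion_of_directed]
  · congr 2
    ext s
    simp only [mem_Ioi, mem_iUnion, mem_Ioc, exists_and_left, iff_self_and]
    exact fun _ => exists_nat_ge s
  · exact Monotone.directed_le fun i j hij => Ioc_subset_Ioc_right (by exact_mod_cast hij)

/-- An integrable function on `(0, ∞)` has a point splitting its integral in two equal halves. -/
lemma exists_half_setLIntegral {m : ℝ → ℝ≥0∞} (hm : Measurable m)
    (hfin : ∫⁻ s in Ioi (0 : ℝ), m s ≠ ⊤) :
    ∃ t : ℝ, 0 ≤ t ∧ ∫⁻ s in Ioc 0 t, m s = (∫⁻ s in Ioi (0 : ℝ), m s) / 2 ∧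
      ∫⁻ s in Ioi t, m s = (∫⁻ s in Ioi (0 : ℝ), m s) / 2 := by
  set A := ∫⁻ s in Ioi (0 : ℝ), m s with hA
  obtain ⟨t, ht, hhalf⟩ : ∃ t : ℝ, 0 ≤ t ∧ ∫⁻ s in Ioc 0 t, m s = A / 2 := by
    rcases eq_or_ne A 0 with h0 | h0
    · exact ⟨0, le_rfl, by simp [h0]⟩
    have hlt : A / 2 < ⨆ k : ℕ, ∫⁻ s in Ioc (0 : ℝ) k, m s := by
      rw [← setLIntegral_Ioi_eq_iSup]
      exact ENNReal.half_lt_self h0 hfin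
    obtain ⟨k, hk⟩ := lt_iSup_iff.1 hlt
    have hint : IntegrableOn (fun s => (m s).toReal) (Ioi 0) :=
      integrable_toReal_of_lintegral_ne_top hm.aemeasurable hfin
    have hae : ∀ᵐ s ∂volume.restrict (Ioi (0 : ℝ)), m s < ⊤ := ae_lt_top hm hfin
    have heq : ∀ t : ℝ, ENNReal.ofReal (∫ s in Ioc 0 t, (m s).toReal) = ∫⁻ s in Ioc 0 t, m s := by
      intro t
      have hsub : Ioc 0 t ⊆ Ioi (0 : ℝ) := Ioc_subset_Ioi_self
      rw [integral_toReal hm.aemeasurable (ae_restrict_of_ae_restrict_of_subset hsub hae),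
        ENNReal.ofReal_toReal]
      exact ne_top_of_le_ne_top hfin (lintegral_mono_set hsub)
    have hcont : ContinuousOn (fun t : ℝ => ∫⁻ s in Ioc 0 t, m s) (Icc 0 k) := by
      simp only [← heq]
      refine ENNReal.continuous_ofReal.comp_continuousOn
        (intervalIntegral.continuousOn_primitive ?_)
      rw [integrableOn_Icc_iff_integrableOn_Ioc]
      exact hint.mono_set Ioc_subset_Ioi_self
    obtain ⟨t, ht, h1⟩ := intermediate_value_Icc (Nat.cast_nonneg k) hcont
      (show A / 2 ∈ Icc _ _ from ⟨by simp, hk.le⟩)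
    exact ⟨t, ht.1, h1⟩
  refine ⟨t, ht, hhalf, ?_⟩
  have hsplit : A = (∫⁻ s in Ioc 0 t, m s) + ∫⁻ s in Ioi t, m s := by
    rw [hA, ← Ioc_union_Ioi_eq_Ioi ht, lintegral_union measurableSet_Ioi]
    exact Set.disjoint_left.2 fun s hs hs' => absurd hs.2 (not_le.2 hs')
  rw [hhalf] at hsplit
  have hne : A / 2 ≠ ⊤ := (ENNReal.div_lt_top hfin (by simp)).ne
  refine (ENNReal.add_right_inj hne).1 ?_
  rw [← hsplit, ENNReal.add_halves]

section Supersolution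

variable {n : ℕ} {p q γ : ℝ} {h : ℝ≥0∞ → ℝ≥0∞} {σ : Measure (EuclideanSpace ℝ (Fin n))}
  {u : EuclideanSpace ℝ (Fin n) → ℝ≥0∞} {B : Set (EuclideanSpace ℝ (Fin n))}

lemma bootstrap_lower_bound (hp : 1 < p) (hpq : p < q) (hγ0 : 0 < γ)
    (hgh : ∀ t, h (gfun p q t) = t) (hhg : ∀ s, gfun p q (h s) = s)
    (hB : MeasurableSet B) (hfin : ∀ x, wolffG n h (σ.restrict B) x < ⊤)
    (hsuper : ∀ x, wolffG n h (σ.withDensity fun y => ffun p q γ (u y)) x ≤ u x)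
    {δ : ℝ≥0∞} {r : ℝ} (hr0 : 0 ≤ r) (hr1 : γ * r + 1 ≤ 1 / (1 - γ))
    (hu : ∀ x ∈ B, δ * wolffG n h (σ.restrict B) x ^ r ≤ u x) (x : EuclideanSpace ℝ (Fin n)) :
    (h (2 ^ (n - 1))⁻¹ / 2) ^ (1 / (1 - γ)) * δ ^ γ * wolffG n h (σ.restrict B) x ^ (γ * r + 1)
      ≤ u x := by
  set τ := σ.restrict B with hτ
  set c := h (2 ^ (n - 1))⁻¹ with hc
  set A := wolffG n h τ x with hA
  have hmono := inverse_mono hp hpq hhg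
  have hc1 : c ≤ 1 := inverse_le_one hp hpq hgh hhg
    (ENNReal.inv_le_one.2 (one_le_pow₀ one_le_two))
  obtain ⟨t, ht, hlow, hhigh⟩ := exists_half_setLIntegral
    (measurable_wolffG_integrand (τ := τ) hmono x) (hfin x).ne
  change _ = A / 2 at hlow hhigh
  set κ := δ * (c * (A / 2)) ^ r with hκ
  have hκu : ∀ y ∈ B ∩ ball x t, κ ≤ u y := by
    intro y hy
    refine le_trans ?_ (hu y hy.1)
    rw [hκ, ← hhigh]
    gcongr
    refine mul_tail_le_wolffG hmono (fun s => ?_) rfl ht hy.2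
    have := mul_inverse_le hp hpq hgh hhg c s
    rwa [hc, hhg] at this
  have hpot : κ ^ γ * (A / 2) ≤ u x := by
    refine le_trans ?_ (hsuper x)
    rw [← hlow, ← lintegral_const_mul _ (measurable_wolffG_integrand hmono x)]
    refine le_trans (setLIntegral_mono' measurableSet_Ioc fun s hs => ?_)
      (lintegral_mono_set Ioc_subset_Ioi_self)
    refine (mul_inverse_le hp hpq hgh hhg _ _).trans (hmono ?_)
    rw [← mul_div_assoc, ← ffun_eq_gfun_rpow]
    refine ENNReal.div_le_div_right ?_ _
    rw [withDensity_apply _ measurableSet_ball, hτ, Measure.restrict_apply measurableSet_ball,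
      ← setLIntegral_const]
    refine (setLIntegral_mono' (measurableSet_ball.inter hB) fun y hy => ?_).trans
      (lintegral_mono_set inter_subset_left)
    exact ffun_mono hp hpq hγ0.le (hκu y ⟨hy.2, ball_subset_ball hs.2 hy.1⟩)
  refine le_trans ?_ hpot
  have hA2 : c / 2 * A = c * (A / 2) := by simp only [div_eq_mul_inv]; ring
  have hrγ : 0 ≤ γ * r := by positivity
  calc (c / 2) ^ (1 / (1 - γ)) * δ ^ γ * A ^ (γ * r + 1)
      ≤ (c / 2) ^ (γ * r + 1) * δ ^ γ * A ^ (γ * r + 1) := by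
        gcongr ?_ * _ * _
        exact ENNReal.rpow_le_rpow_of_exponent_ge (ENNReal.half_le_self.trans hc1) hr1
    _ = δ ^ γ * (c * (A / 2)) ^ (γ * r + 1) := by
        rw [← hA2, ENNReal.mul_rpow_of_nonneg _ _ (by positivity)]
        ring
    _ = κ ^ γ * (c * (A / 2)) := by
        rw [hκ, ENNReal.mul_rpow_of_nonneg _ _ hγ0.le, ← ENNReal.rpow_mul,
          ENNReal.rpow_add_of_nonneg _ _ hrγ zero_le_one, ENNReal.rpow_one, mul_comm r, mul_assoc]
    _ ≤ κ ^ γ * (A / 2) := by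
        gcongr
        exact mul_le_of_le_one_left' hc1

/-- The exponents produced by iterating `r ↦ γ * r + 1` from `0`. -/
lemma affine_iterate_exponent (hγ1 : γ < 1) (k : ℕ) :
    γ * ((1 - γ ^ k) / (1 - γ)) + 1 = (1 - γ ^ (k + 1)) / (1 - γ) := by
  have : 1 - γ ≠ 0 := by linarith
  field_simp
  ring

lemma iterated_lower_bound (hp : 1 < p) (hpq : p < q) (hγ0 : 0 < γ) (hγ1 : γ < 1)
    (hgh : ∀ t, h (gfun p q t) = t) (hhg : ∀ s, gfun p q (h s) = s)
    (hB : MeasurableSet B) (hfin : ∀ x, wolffG n h (σ.restrict B) x < ⊤)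
    (hsuper : ∀ x, wolffG n h (σ.withDensity fun y => ffun p q γ (u y)) x ≤ u x)
    {δ : ℝ≥0∞} (hu : ∀ x ∈ B, δ ≤ u x) (k : ℕ) :
    ∀ x ∈ B, ((h (2 ^ (n - 1))⁻¹ / 2) ^ (1 / (1 - γ))) ^ ((1 - γ ^ k) / (1 - γ)) * δ ^ (γ ^ k) *
      wolffG n h (σ.restrict B) x ^ ((1 - γ ^ k) / (1 - γ)) ≤ u x := by
  have h1γ : 0 < 1 - γ := by linarith
  induction k with
  | zero => simpa using hu
  | succ k ih =>
    intro x _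
    have hk1 : γ ^ k ≤ 1 := pow_le_one₀ hγ0.le hγ1.le
    have hr0 : 0 ≤ (1 - γ ^ k) / (1 - γ) := div_nonneg (by linarith) h1γ.le
    have hr1 : γ * ((1 - γ ^ k) / (1 - γ)) + 1 ≤ 1 / (1 - γ) := by
      rw [affine_iterate_exponent hγ1]
      gcongr
      linarith [pow_pos hγ0 (k + 1)]
    refine le_trans (le_of_eq ?_)
      (bootstrap_lower_bound hp hpq hγ0 hgh hhg hB hfin hsuper hr0 hr1 ih x)
    generalize (h (2 ^ (n - 1))⁻¹ / 2) ^ (1 / (1 - γ)) = K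
    rw [← affine_iterate_exponent hγ1, ENNReal.mul_rpow_of_nonneg _ _ hγ0.le,
      ← ENNReal.rpow_mul δ, ← pow_succ, ← ENNReal.rpow_mul K, mul_comm _ γ,
      ENNReal.rpow_add_of_nonneg (x := K) _ _ (by positivity) zero_le_one, ENNReal.rpow_one]
    ring

lemma restricted_lower_bound (hp : 1 < p) (hpq : p < q) (hγ0 : 0 < γ) (hγ1 : γ < 1)
    (hgh : ∀ t, h (gfun p q t) = t) (hhg : ∀ s, gfun p q (h s) = s)
    (hB : MeasurableSet B) (hfin : ∀ x, wolffG n h (σ.restrict B) x < ⊤)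
    (hsuper : ∀ x, wolffG n h (σ.withDensity fun y => ffun p q γ (u y)) x ≤ u x)
    {δ : ℝ≥0∞} (hδ : δ ≠ 0) (hu : ∀ x ∈ B, δ ≤ u x) {x : EuclideanSpace ℝ (Fin n)} (hx : x ∈ B) :
    ((h (2 ^ (n - 1))⁻¹ / 2) ^ (1 / (1 - γ)) * wolffG n h (σ.restrict B) x) ^ (1 / (1 - γ))
      ≤ u x := by
  have h1γ : 0 < 1 - γ := by linarith
  set K := (h (2 ^ (n - 1))⁻¹ / 2) ^ (1 / (1 - γ)) with hK
  set A := wolffG n h (σ.restrict B) x with hA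
  have hKtop : K ≠ ⊤ := by
    refine ENNReal.rpow_ne_top_of_nonneg (by positivity) ?_
    refine (ENNReal.div_lt_top (ne_top_of_le_ne_top ENNReal.one_ne_top ?_) (by simp)).ne
    exact inverse_le_one hp hpq hgh hhg (ENNReal.inv_le_one.2 (one_le_pow₀ one_le_two))
  rcases eq_or_ne (K * A) 0 with h0 | h0
  · simp [h0, ENNReal.zero_rpow_of_pos (show 0 < (1 - γ)⁻¹ by positivity)]
  have hKA : K * A ≠ ⊤ := ENNReal.mul_ne_top hKtop (hfin x).ne
  set ε := min δ 1 with hε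
  have hε0 : ε ≠ 0 := (lt_min (pos_iff_ne_zero.2 hδ) one_pos).ne'
  have hεtop : ε ≠ ⊤ := ne_top_of_le_ne_top ENNReal.one_ne_top (min_le_right _ _)
  have hiter := fun k => iterated_lower_bound hp hpq hγ0 hγ1 hgh hhg hB hfin hsuper
    (fun x hx => (min_le_left δ 1).trans (hu x hx)) k x hx
  have hpow : Filter.Tendsto (fun k : ℕ => γ ^ k) Filter.atTop (nhds 0) :=
    tendsto_pow_atTop_nhds_zero_of_lt_one hγ0.le hγ1
  have hconst : ∀ {a : ℝ≥0∞}, a ≠ 0 → a ≠ ⊤ → Continuous fun y : ℝ => a ^ y := by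
    intro a ha0 ha
    have hapos := ENNReal.toReal_pos ha0 ha
    rw [← ENNReal.ofReal_toReal ha]
    simp only [ENNReal.ofReal_rpow_of_pos hapos]
    exact ENNReal.continuous_ofReal.comp (Real.continuous_const_rpow hapos.ne')
  have hexp : Filter.Tendsto (fun k : ℕ => (1 - γ ^ k) / (1 - γ)) Filter.atTop
      (nhds (1 / (1 - γ))) := by
    simpa using (hpow.const_sub 1).div_const (1 - γ)
  have hlim : Filter.Tendsto
      (fun k : ℕ => (K * A) ^ ((1 - γ ^ k) / (1 - γ)) * ε ^ (γ ^ k)) Filter.atTop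
      (nhds ((K * A) ^ (1 / (1 - γ)) * 1)) := by
    refine ENNReal.Tendsto.mul (((hconst h0 hKA).tendsto _).comp hexp) (Or.inr (by simp)) ?_
      (Or.inl (by simp))
    simpa [Function.comp_def] using ((hconst hε0 hεtop).tendsto 0).comp hpow
  rw [mul_one] at hlim
  refine le_of_tendsto hlim (Filter.Eventually.of_forall fun k => le_trans (le_of_eq ?_) (hiter k))
  have hk1 : γ ^ k ≤ 1 := pow_le_one₀ hγ0.le hγ1.le
  rw [ENNReal.mul_rpow_of_nonneg _ _ (div_nonneg (by linarith) h1γ.le)]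
  ring

lemma supersolution_lower_bound_on_ball (hp : 1 < p) (hpq : p < q)
    (hhg : ∀ s, gfun p q (h s) = s) {μ : Measure (EuclideanSpace ℝ (Fin n))}
    (hsuper : ∀ x, wolffG n h μ x ≤ u x) {R : ℝ} (hR : 0 ≤ R)
    (hμ : μ (ball 0 R) ≠ 0) :
    ∃ δ : ℝ≥0∞, δ ≠ 0 ∧ ∀ x ∈ ball 0 R, δ ≤ u x := by
  have hmono := inverse_mono hp hpq hhg
  refine ⟨h (μ (ball 0 R) / ENNReal.ofReal (2 * R + 1) ^ (n - 1)),
    inverse_ne_zero hp hpq hhg (ENNReal.div_ne_zero.2 ⟨hμ, by simp⟩), fun x hx => ?_⟩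
  have hx' : ‖x‖ < R := by simpa using hx
  calc h (μ (ball 0 R) / ENNReal.ofReal (2 * R + 1) ^ (n - 1))
      = ∫⁻ _ in Ioc (2 * R) (2 * R + 1),
          h (μ (ball 0 R) / ENNReal.ofReal (2 * R + 1) ^ (n - 1)) := by
        simp
    _ ≤ ∫⁻ t in Ioc (2 * R) (2 * R + 1), h (μ (ball x t) / ENNReal.ofReal t ^ (n - 1)) := by
        refine setLIntegral_mono' measurableSet_Ioc fun t ht => hmono ?_
        have hsub : ball 0 R ⊆ ball x t := by
          refine ball_subset_ball' ?_
          rw [dist_zero_left]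
          linarith [ht.1]
        exact ENNReal.div_le_div (measure_mono hsub)
          (pow_le_pow_left' (ENNReal.ofReal_le_ofReal ht.2) _)
    _ ≤ wolffG n h μ x := by
        refine lintegral_mono_set fun t ht => ?_
        rw [mem_Ioi]
        linarith [ht.1]
    _ ≤ u x := hsuper x

lemma exists_ball_withDensity_ne_zero (hp : 1 < p) (hγ0 : 0 < γ) (hum : Measurable u)
    (hpos : 0 < σ {x | 0 < u x}) :
    ∃ N : ℕ, (σ.withDensity fun y => ffun p q γ (u y)) (ball 0 N) ≠ 0 := by
  by_contra! hzero
  have hnull : (σ.withDensity fun y => ffun p q γ (u y)) univ = 0 := by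
    rw [← iUnion_ball_nat 0]
    exact measure_iUnion_null hzero
  rw [withDensity_apply _ MeasurableSet.univ, Measure.restrict_univ,
    lintegral_eq_zero_iff (by exact measurable_ffun.comp hum)] at hnull
  refine hpos.ne' (measure_mono_null (fun x hx => ?_) (ae_iff.1 hnull))
  exact ffun_ne_zero hp hγ0 (ne_of_gt hx)

end Supersolution

/-- Theorem (lower bound for nontrivial supersolutions of the Wolff integral equation). -/
theorem lower_bound_supersolution
    (n : ℕ) (hn : 3 ≤ n) (p q γ : ℝ) (hp : 1 < p) (hpq : p < q)
    (hγ0 : 0 < γ) (hγ : γ < min ((p - 1) / (q - 1)) (1 / (q - p)))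
    (h : ℝ≥0∞ → ℝ≥0∞)
    (hgh : ∀ t, h (gfun p q t) = t) (hhg : ∀ s, gfun p q (h s) = s) :
    ∃ C : ℝ, 0 < C ∧ C < 1 ∧
      ∀ σ : Measure (EuclideanSpace ℝ (Fin n)),
        (∀ (x : EuclideanSpace ℝ (Fin n)) (r : ℝ), σ (ball x r) < ⊤) →
        (∀ x, wolffG n h σ x < ⊤) →
        ∀ u : EuclideanSpace ℝ (Fin n) → ℝ≥0∞, Measurable u →
          0 < σ {x | 0 < u x} →
          (∀ x, wolffG n h (σ.withDensity fun y => ffun p q γ (u y)) x ≤ u x) →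
          ∀ x, ENNReal.ofReal C * (wolffG n h σ x) ^ (1 / (1 - γ)) ≤ u x := by
  have hq1 : 0 < q - 1 := by linarith
  have hγ1 : γ < 1 := (hγ.trans_le (min_le_left _ _)).trans ((div_lt_one hq1).2 (by linarith))
  have h1γ : 0 < 1 - γ := by linarith
  have he : 0 < 1 / (1 - γ) := by positivity
  have hmono := inverse_mono hp hpq hhg
  set c := h (2 ^ (n - 1))⁻¹ with hc
  have hc1 : c ≤ 1 := inverse_le_one hp hpq hgh hhg
    (ENNReal.inv_le_one.2 (one_le_pow₀ one_le_two))
  have hc0 : c ≠ 0 := inverse_ne_zero hp hpq hhg (by simp)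
  have hctop : c ≠ ⊤ := ne_top_of_le_ne_top ENNReal.one_ne_top hc1
  set D := ((c / 2) ^ (1 / (1 - γ))) ^ (1 / (1 - γ)) with hD
  have hhalf : c / 2 < 1 := (ENNReal.half_lt_self hc0 hctop).trans_le hc1
  have hD1 : D < 1 := ENNReal.rpow_lt_one (ENNReal.rpow_lt_one hhalf he) he
  have hDtop : D ≠ ⊤ := (hD1.trans ENNReal.one_lt_top).ne
  have hD0 : D ≠ 0 := by
    have : c / 2 ≠ 0 := ENNReal.div_ne_zero.2 ⟨hc0, by simp⟩
    simp [hD, ENNReal.rpow_eq_zero_iff, this, hctop, ENNReal.div_eq_top]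
  refine ⟨D.toReal, ENNReal.toReal_pos hD0 hDtop, ?_, ?_⟩
  · simpa using (ENNReal.toReal_lt_toReal hDtop ENNReal.one_ne_top).2 hD1
  intro σ _ hfin u hum hpos hsuper x
  rw [ENNReal.ofReal_toReal hDtop]
  obtain ⟨N, hN⟩ := exists_ball_withDensity_ne_zero (q := q) hp hγ0 hum hpos
  set m : ℝ → ℝ≥0∞ := fun t => h (σ (ball x t) / ENNReal.ofReal t ^ (n - 1)) with hm
  have htrunc : ∀ k : ℕ, D * (∫⁻ t in Ioc (0 : ℝ) k, m t) ^ (1 / (1 - γ)) ≤ u x := by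
    intro k
    set R : ℝ := k + N + ‖x‖ + 1 with hR
    have hk0 : (0 : ℝ) ≤ k := k.cast_nonneg
    have hN0 : (0 : ℝ) ≤ N := N.cast_nonneg
    have hx0 := norm_nonneg x
    obtain ⟨δ, hδ0, hδ⟩ := supersolution_lower_bound_on_ball hp hpq hhg hsuper
      (R := R) (by linarith)
      (fun h0 => hN (measure_mono_null (ball_subset_ball (by linarith)) h0))
    have hxR : x ∈ ball 0 R := by
      rw [mem_ball_zero_iff]
      linarith
    have hbound := restricted_lower_bound hp hpq hγ0 hγ1 hgh hhg measurableSet_ball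
      (fun y => (wolffG_mono_measure hmono Measure.restrict_le_self y).trans_lt (hfin y))
      hsuper hδ0 hδ hxR
    rw [ENNReal.mul_rpow_of_nonneg _ _ he.le] at hbound
    refine le_trans ?_ hbound
    gcongr
    refine (setLIntegral_mono' measurableSet_Ioc fun t ht => le_of_eq ?_).trans
      (lintegral_mono_set Ioc_subset_Ioi_self)
    have hsub : ball x t ⊆ ball 0 R := by
      refine ball_subset_ball' ?_
      rw [dist_zero_right]
      linarith [ht.2]
    rw [Measure.restrict_apply measurableSet_ball, inter_eq_left.2 hsub]
  have hlim : Filter.Tendsto (fun k : ℕ => ∫⁻ t in Ioc (0 : ℝ) k, m t) Filter.atTop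
      (nhds (wolffG n h σ x)) := by
    rw [wolffG, setLIntegral_Ioi_eq_iSup]
    exact tendsto_atTop_iSup fun i j hij =>
      lintegral_mono_set (Ioc_subset_Ioc_right (by exact_mod_cast hij))
  exact le_of_tendsto' (ENNReal.Tendsto.const_mul (hlim.ennrpow_const _) (Or.inr hDtop)) htrunc
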